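/- Let (𝒜×ℬ, μ) and (𝒰×𝒱, ν) be finite joint probability spaces. If ν can be non-interactively simulated from μ, then ρ(𝒜,ℬ;μ) ≥ ρ(𝒰,𝒱;ν). -/

import Mathlib

open Finset MeasureTheory ProbabilityTheory Filter
open scoped Classical

noncomputable section

namespace NIS

/-- Expectation of `f` under the weight function `p` on a finite type. -/
def pmean {Ω : Type*} [Fintype Ω] (p : Ω → ℝ) (f : Ω → ℝ) : ℝ := ∑ ω, p ω * f ω

/-- Variance of `f` under the weight function `p` on a finite type. -/
def pvar {Ω : Type*} [Fintype Ω] (p : Ω → ℝ) (f : Ω → ℝ) : ℝ :=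
  pmean p (fun ω => (f ω - pmean p f) ^ 2)

/-- `p` is a probability distribution on the finite type `Ω`. -/
def IsDist {Ω : Type*} [Fintype Ω] (p : Ω → ℝ) : Prop :=
  (∀ ω, 0 ≤ p ω) ∧ ∑ ω, p ω = 1

/-- Probability of the event `E` under the weight function `p`. -/
def pprob {Ω : Type*} [Fintype Ω] (p : Ω → ℝ) (E : Ω → Prop) : ℝ :=
  ∑ ω, if E ω then p ω else 0

/-- Total variation distance between two distributions on a finite type. -/
def tvDist {Ω : Type*} [Fintype Ω] (p q : Ω → ℝ) : ℝ := (1 / 2) * ∑ ω, |p ω - q ω|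

/-- Marginal on the first coordinate of a joint distribution. -/
def marginalA {A B : Type*} [Fintype A] [Fintype B] (μ : A × B → ℝ) : A → ℝ :=
  fun a => ∑ b, μ (a, b)

/-- Marginal on the second coordinate of a joint distribution. -/
def marginalB {A B : Type*} [Fintype A] [Fintype B] (μ : A × B → ℝ) : B → ℝ :=
  fun b => ∑ a, μ (a, b)

/-- The Hirschfeld–Gebelein–Rényi maximal correlation of a finite joint distribution. -/
def maxCorr {A B : Type*} [Fintype A] [Fintype B] (μ : A × B → ℝ) : ℝ :=
  sSup { r | ∃ f : A → ℝ, ∃ g : B → ℝ,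
    pmean (marginalA μ) f = 0 ∧ pmean (marginalB μ) g = 0 ∧
    pvar (marginalA μ) f = 1 ∧ pvar (marginalB μ) g = 1 ∧
    pmean μ (fun ab => f ab.1 * g ab.2) = r }

/-- `n`-fold product distribution of a distribution `μA` on `A`. -/
def prodDist {A : Type*} [Fintype A] (μA : A → ℝ) (n : ℕ) : (Fin n → A) → ℝ :=
  fun x => ∏ i, μA (x i)

/-- `n`-fold product of a joint distribution `μ` on `A × B`, identified with a distribution on
`A^n × B^n`. -/
def prodPair {A B : Type*} [Fintype A] [Fintype B] (μ : A × B → ℝ) (n : ℕ) :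
    (Fin n → A) × (Fin n → B) → ℝ :=
  fun p => ∏ i, μ (p.1 i, p.2 i)

/-- The influence of coordinate `i` on `f : A^n → ℝ` with respect to `μA^{⊗n}`:
`Inf_i(f) = E_{x_{-i}}[Var_{x_i} f] = ½ E_{x, a}[(f(x) - f(x_i ← a))²]`. -/
def influence {A : Type*} [Fintype A] {n : ℕ} (μA : A → ℝ) (i : Fin n)
    (f : (Fin n → A) → ℝ) : ℝ :=
  (1 / 2) * ∑ x : Fin n → A, ∑ a : A,
    (∏ j, μA (x j)) * μA a * (f x - f (Function.update x i a)) ^ 2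

/-- Total influence of `f`. -/
def totalInfluence {A : Type*} [Fintype A] {n : ℕ} (μA : A → ℝ)
    (f : (Fin n → A) → ℝ) : ℝ :=
  ∑ i, influence μA i f

/-- `g` depends on at most `d` coordinates. -/
def DependsOnLE {A : Type*} {n : ℕ} (d : ℕ) (g : (Fin n → A) → ℝ) : Prop :=
  ∃ J : Finset (Fin n), J.card ≤ d ∧
    ∀ x y : Fin n → A, (∀ i ∈ J, x i = y i) → g x = g y

/-- `f` has degree at most `d`: it lies in the linear span of functions each depending on at
most `d` coordinates. -/
def degLE {A : Type*} {n : ℕ} (d : ℕ) (f : (Fin n → A) → ℝ) : Prop :=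
  f ∈ Submodule.span ℝ { g : (Fin n → A) → ℝ | DependsOnLE d g }

/-- Restriction of `P` fixing the coordinates in `H` to the values of `ξ`; the result only
depends on the coordinates outside `H`. -/
def restrictFn {A : Type*} {n : ℕ} (H : Finset (Fin n)) (ξ : Fin n → A)
    (P : (Fin n → A) → ℝ) : (Fin n → A) → ℝ :=
  fun x => P (fun i => if i ∈ H then ξ i else x i)

/-- The 2-dimensional Gaussian distribution `G(ρ)` with standard normal marginals and
correlation `ρ`. -/
def gauss2 (ρ : ℝ) : Measure (ℝ × ℝ) :=
  Measure.map (fun p : ℝ × ℝ => (p.1, ρ * p.1 + Real.sqrt (1 - ρ ^ 2) * p.2))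
    ((gaussianReal 0 1).prod (gaussianReal 0 1))

/-- The standard normal cumulative distribution function `Φ`. -/
def stdNormalCDF (t : ℝ) : ℝ := ((gaussianReal 0 1) (Set.Iic t)).toReal

/-- The inverse `Φ⁻¹` of the standard normal CDF (junk values outside `(0,1)`). -/
def stdNormalCDFInv : ℝ → ℝ := Function.invFun stdNormalCDF

/-- The ±1-valued threshold function: `thr t r = 1` if `r ≥ t`, and `-1` otherwise. -/
def thr (t r : ℝ) : ℝ := if t ≤ r then 1 else -1

/-- The Gaussian stability quantity `Γ̄_ρ(m, v)`. -/
def Gammabar (ρ m v : ℝ) : ℝ :=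
  ∫ q : ℝ × ℝ, (if q.1 ≤ stdNormalCDFInv ((1 + m) / 2) then (1 : ℝ) else -1) *
    (if q.2 ≤ stdNormalCDFInv ((1 + v) / 2) then (1 : ℝ) else -1) ∂(gauss2 ρ)

/-- Pushforward of `μ^{⊗n}` under the pair of maps `(f, g)`. -/
def push {A B U V : Type*} [Fintype A] [Fintype B] (μ : A × B → ℝ) (n : ℕ)
    (f : (Fin n → A) → U) (g : (Fin n → B) → V) : U × V → ℝ :=
  fun uv => ∑ z : Fin n → A × B,
    if f (fun i => (z i).1) = uv.1 ∧ g (fun i => (z i).2) = uv.2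
    then ∏ i, μ (z i) else 0

/-- `ν` can be non-interactively simulated from `μ`. -/
def CanSimulate {A B U V : Type*} [Fintype A] [Fintype B] [Fintype U] [Fintype V]
    (μ : A × B → ℝ) (ν : U × V → ℝ) : Prop :=
  ∃ f : (n : ℕ) → (Fin n → A) → U, ∃ g : (n : ℕ) → (Fin n → B) → V,
    Tendsto (fun n => tvDist (push μ n (f n) (g n)) ν) atTop (nhds 0)

/-- The doubly symmetric binary source `DSBS(ρ)`, as a distribution on `Bool × Bool`, where
`true` encodes `+1` and `false` encodes `-1`. -/
def DSBS (ρ : ℝ) : Bool × Bool → ℝ :=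
  fun bv => if bv.1 = bv.2 then (1 + ρ) / 4 else (1 - ρ) / 4

/-- The ±1 value encoded by a Boolean. -/
def sgn (b : Bool) : ℝ := if b then 1 else -1

/-- Minimum nonzero probability of an atom. -/
def minAtom {A : Type*} [Fintype A] (μA : A → ℝ) : ℝ :=
  sInf { x | ∃ a, μA a = x ∧ 0 < x }

/-- The hypercontractivity constant `C₄(α)`. -/
def C4 (α : ℝ) : ℝ :=
  if α = 1 / 2 then 3 else
    (((1 - α) / α) ^ ((3 : ℝ) / 4) - ((1 - α) / α) ^ (-((3 : ℝ) / 4))) /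
    (((1 - α) / α) ^ ((1 : ℝ) / 4) - ((1 - α) / α) ^ (-((1 : ℝ) / 4)))

theorem pmean_add {Ω : Type*} [Fintype Ω] (p f g : Ω → ℝ) :
    pmean p (fun ω => f ω + g ω) = pmean p f + pmean p g := by
  simp [pmean, mul_add, Finset.sum_add_distrib]

theorem pmean_sub {Ω : Type*} [Fintype Ω] (p f g : Ω → ℝ) :
    pmean p (fun ω => f ω - g ω) = pmean p f - pmean p g := by
  simp [pmean, mul_sub, Finset.sum_sub_distrib]

theorem pmean_const_mul {Ω : Type*} [Fintype Ω] (p : Ω → ℝ) (c : ℝ) (f : Ω → ℝ) :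
    pmean p (fun ω => c * f ω) = c * pmean p f := by
  simp only [pmean, Finset.mul_sum]
  exact Finset.sum_congr rfl fun _ _ => by ring

theorem pmean_const {Ω : Type*} [Fintype Ω] {p : Ω → ℝ} (hp : IsDist p) (c : ℝ) :
    pmean p (fun _ => c) = c := by
  simp [pmean, ← Finset.sum_mul, hp.2]

theorem pmean_nonneg {Ω : Type*} [Fintype Ω] {p : Ω → ℝ} (hp : IsDist p) {f : Ω → ℝ}
    (hf : ∀ ω, 0 ≤ f ω) : 0 ≤ pmean p f :=
  Finset.sum_nonneg fun ω _ => mul_nonneg (hp.1 ω) (hf ω)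

theorem pmean_mono {Ω : Type*} [Fintype Ω] {p : Ω → ℝ} (hp : IsDist p) {f g : Ω → ℝ}
    (hfg : ∀ ω, f ω ≤ g ω) : pmean p f ≤ pmean p g :=
  Finset.sum_le_sum fun ω _ => mul_le_mul_of_nonneg_left (hfg ω) (hp.1 ω)

theorem pmean_marginalA {A B : Type*} [Fintype A] [Fintype B] (μ : A × B → ℝ) (f : A → ℝ) :
    pmean (marginalA μ) f = pmean μ (fun ab => f ab.1) := by
  simp [pmean, marginalA, Fintype.sum_prod_type, Finset.sum_mul]

theorem pmean_marginalB {A B : Type*} [Fintype A] [Fintype B] (μ : A × B → ℝ) (g : B → ℝ) :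
    pmean (marginalB μ) g = pmean μ (fun ab => g ab.2) := by
  simp [pmean, marginalB, Fintype.sum_prod_type_right, Finset.sum_mul]

theorem pvar_marginalA {A B : Type*} [Fintype A] [Fintype B] (μ : A × B → ℝ) (f : A → ℝ) :
    pvar (marginalA μ) f = pvar μ (fun ab => f ab.1) := by
  simp only [pvar, pmean_marginalA]

theorem pvar_marginalB {A B : Type*} [Fintype A] [Fintype B] (μ : A × B → ℝ) (g : B → ℝ) :
    pvar (marginalB μ) g = pvar μ (fun ab => g ab.2) := by
  simp only [pvar, pmean_marginalB]

/-- Covariance of `f` and `g` under the weight function `p`. -/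
def pcov {Ω : Type*} [Fintype Ω] (p : Ω → ℝ) (f g : Ω → ℝ) : ℝ :=
  pmean p (fun ω => f ω * g ω) - pmean p f * pmean p g

theorem pmean_mul_centered {Ω : Type*} [Fintype Ω] {p : Ω → ℝ} (hp : IsDist p) (f g : Ω → ℝ) :
    pmean p (fun ω => (f ω - pmean p f) * (g ω - pmean p g)) = pcov p f g := by
  have h : (fun ω => (f ω - pmean p f) * (g ω - pmean p g)) =
      fun ω => (f ω * g ω - pmean p f * g ω) - (pmean p g * f ω - pmean p f * pmean p g) := by
    funext ω; ring
  rw [h, pmean_sub, pmean_sub, pmean_sub, pmean_const_mul, pmean_const_mul, pmean_const hp, pcov]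
  ring

theorem pcov_self {Ω : Type*} [Fintype Ω] {p : Ω → ℝ} (hp : IsDist p) (f : Ω → ℝ) :
    pcov p f f = pvar p f := by
  simp only [← pmean_mul_centered hp, pvar, sq]

theorem pvar_nonneg {Ω : Type*} [Fintype Ω] {p : Ω → ℝ} (hp : IsDist p) (f : Ω → ℝ) :
    0 ≤ pvar p f :=
  pmean_nonneg hp fun _ => sq_nonneg _

/-- The Cauchy–Schwarz inequality for covariances. -/
theorem pcov_sq_le {Ω : Type*} [Fintype Ω] {p : Ω → ℝ} (hp : IsDist p) (f g : Ω → ℝ) :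
    pcov p f g ^ 2 ≤ pvar p f * pvar p g := by
  rw [← pmean_mul_centered hp]
  refine Finset.sum_sq_le_sum_mul_sum_of_sq_le_mul _
    (fun ω _ => mul_nonneg (hp.1 ω) (sq_nonneg _))
    (fun ω _ => mul_nonneg (hp.1 ω) (sq_nonneg _)) fun ω _ => le_of_eq (by ring)

/-- The maximal correlation of the random variables `X` and `Y` under `p` is at most `r`,
in a form that is linear in the covariances. -/
def CorrLE {Ω A B : Type*} [Fintype Ω] (p : Ω → ℝ) (X : Ω → A) (Y : Ω → B) (r : ℝ) : Prop :=
  ∀ (f : A → ℝ) (g : B → ℝ),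
    2 * pcov p (fun ω => f (X ω)) (fun ω => g (Y ω)) ≤
      r * (pcov p (fun ω => f (X ω)) (fun ω => f (X ω)) +
        pcov p (fun ω => g (Y ω)) (fun ω => g (Y ω)))

/-- The normalized correlations whose supremum is `maxCorr μ`. -/
def corrSet {A B : Type*} [Fintype A] [Fintype B] (μ : A × B → ℝ) : Set ℝ :=
  { r | ∃ f : A → ℝ, ∃ g : B → ℝ,
    pmean (marginalA μ) f = 0 ∧ pmean (marginalB μ) g = 0 ∧
    pvar (marginalA μ) f = 1 ∧ pvar (marginalB μ) g = 1 ∧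
    pmean μ (fun ab => f ab.1 * g ab.2) = r }

theorem le_one_of_mem_corrSet {A B : Type*} [Fintype A] [Fintype B] {μ : A × B → ℝ}
    (hμ : IsDist μ) {r : ℝ} (hr : r ∈ corrSet μ) : r ≤ 1 := by
  obtain ⟨f, g, hf, hg, hvf, hvg, rfl⟩ := hr
  rw [pmean_marginalA] at hf
  rw [pvar_marginalA] at hvf
  rw [pvar_marginalB] at hvg
  have h := pcov_sq_le hμ (fun ab => f ab.1) (fun ab => g ab.2)
  rw [hvf, hvg, pcov, hf, zero_mul, sub_zero] at h
  nlinarith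

theorem neg_mem_corrSet {A B : Type*} [Fintype A] [Fintype B] {μ : A × B → ℝ} {r : ℝ}
    (hr : r ∈ corrSet μ) : -r ∈ corrSet μ := by
  obtain ⟨f, g, hf, hg, hvf, hvg, rfl⟩ := hr
  have hneg : pmean (marginalA μ) (fun a => -f a) = 0 := by
    simpa [hf] using pmean_const_mul (marginalA μ) (-1) f
  refine ⟨fun a => -f a, g, hneg, hg, ?_, hvg, ?_⟩
  · rw [← hvf]
    simp [pvar, hneg, hf]
  · simpa using pmean_const_mul μ (-1) (fun ab => f ab.1 * g ab.2)

theorem le_maxCorr {A B : Type*} [Fintype A] [Fintype B] {μ : A × B → ℝ}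
    (hμ : IsDist μ) {r : ℝ} (hr : r ∈ corrSet μ) : r ≤ maxCorr μ :=
  le_csSup ⟨1, fun _ => le_one_of_mem_corrSet hμ⟩ hr

theorem maxCorr_nonneg {A B : Type*} [Fintype A] [Fintype B] {μ : A × B → ℝ}
    (hμ : IsDist μ) : 0 ≤ maxCorr μ := by
  rcases (corrSet μ).eq_empty_or_nonempty with h | ⟨r, hr⟩
  · change 0 ≤ sSup (corrSet μ)
    simp [h]
  · linarith [le_maxCorr hμ hr, le_maxCorr hμ (neg_mem_corrSet hr)]

theorem pmean_standardize {Ω : Type*} [Fintype Ω] {p : Ω → ℝ} (hp : IsDist p) (f : Ω → ℝ)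
    (s : ℝ) : pmean p (fun ω => s⁻¹ * (f ω - pmean p f)) = 0 := by
  rw [pmean_const_mul, pmean_sub, pmean_const hp, sub_self, mul_zero]

theorem pvar_standardize {Ω : Type*} [Fintype Ω] {p : Ω → ℝ} (hp : IsDist p) {f : Ω → ℝ}
    {s : ℝ} (hs : s ≠ 0) (hf : s ^ 2 = pvar p f) :
    pvar p (fun ω => s⁻¹ * (f ω - pmean p f)) = 1 := by
  rw [pvar, pmean_standardize hp]
  simp only [sub_zero, mul_pow]
  rw [pmean_const_mul, ← pvar, ← hf, inv_pow, inv_mul_cancel₀ (pow_ne_zero 2 hs)]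

theorem corrLE_maxCorr {A B : Type*} [Fintype A] [Fintype B] {μ : A × B → ℝ} (hμ : IsDist μ) :
    CorrLE μ Prod.fst Prod.snd (maxCorr μ) := by
  intro f g
  rw [pcov_self hμ, pcov_self hμ]
  set F : A × B → ℝ := fun ab => f ab.1
  set G : A × B → ℝ := fun ab => g ab.2
  have hr := maxCorr_nonneg hμ
  have hF := pvar_nonneg hμ F
  have hG := pvar_nonneg hμ G
  rcases (mul_nonneg hF hG).eq_or_lt with h0 | h0
  · have hc := pcov_sq_le hμ F G
    rw [← h0] at hc
    have : pcov μ F G = 0 := by nlinarith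
    rw [this, mul_zero]
    positivity
  · set s := √(pvar μ F)
    set t := √(pvar μ G)
    have hs2 : s ^ 2 = pvar μ F := Real.sq_sqrt hF
    have ht2 : t ^ 2 = pvar μ G := Real.sq_sqrt hG
    have hs : 0 < s := Real.sqrt_pos.2 (pos_of_mul_pos_left h0 hG)
    have ht : 0 < t := Real.sqrt_pos.2 (pos_of_mul_pos_right h0 hF)
    have hmem : pcov μ F G / (s * t) ∈ corrSet μ := by
      refine ⟨fun a => s⁻¹ * (f a - pmean μ F), fun b => t⁻¹ * (g b - pmean μ G), ?_, ?_, ?_, ?_, ?_⟩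
      · rw [pmean_marginalA]; exact pmean_standardize hμ F s
      · rw [pmean_marginalB]; exact pmean_standardize hμ G t
      · rw [pvar_marginalA]; exact pvar_standardize hμ hs.ne' hs2
      · rw [pvar_marginalB]; exact pvar_standardize hμ ht.ne' ht2
      · rw [← pmean_mul_centered hμ, div_eq_inv_mul, ← pmean_const_mul]
        congr 1
        funext ab
        simp only [F, G, mul_inv]
        ring
    have h := le_maxCorr hμ hmem
    rw [div_le_iff₀ (mul_pos hs ht)] at h
    rw [← hs2, ← ht2]
    nlinarith [mul_nonneg hr (sq_nonneg (s - t))]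

theorem CorrLE.maxCorr_le {A B : Type*} [Fintype A] [Fintype B] {μ : A × B → ℝ} {r : ℝ}
    (hμ : IsDist μ) (hr : 0 ≤ r) (h : CorrLE μ Prod.fst Prod.snd r) : maxCorr μ ≤ r := by
  refine Real.sSup_le ?_ hr
  rintro _ ⟨f, g, hf, hg, hvf, hvg, rfl⟩
  have hfg := h f g
  rw [pmean_marginalA] at hf
  rw [pvar_marginalA] at hvf
  rw [pvar_marginalB] at hvg
  rw [pcov_self hμ, pcov_self hμ, hvf, hvg, pcov, hf] at hfg
  linarith

theorem CorrLE.comp {Ω A B U V : Type*} [Fintype Ω] {p : Ω → ℝ} {X : Ω → A} {Y : Ω → B} {r : ℝ}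
    (h : CorrLE p X Y r) (φ : A → U) (ψ : B → V) :
    CorrLE p (fun ω => φ (X ω)) (fun ω => ψ (Y ω)) r :=
  fun f g => h (fun a => f (φ a)) (fun b => g (ψ b))

theorem pmean_prodDist_succ {Ω : Type*} [Fintype Ω] (p : Ω → ℝ) (n : ℕ)
    (h : (Fin (n + 1) → Ω) → ℝ) :
    pmean (prodDist p (n + 1)) h =
      pmean p (fun a => pmean (prodDist p n) (fun z => h (Fin.cons a z))) := by
  simp only [pmean, prodDist]
  rw [← (Fin.consEquiv fun _ => Ω).sum_comp, Fintype.sum_prod_type]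
  simp [Fin.consEquiv, Fin.prod_univ_succ, Finset.mul_sum, mul_assoc]

/-- The law of total covariance for a product distribution. -/
theorem pcov_prodDist_succ {Ω : Type*} [Fintype Ω] (p : Ω → ℝ) (n : ℕ)
    (f g : (Fin (n + 1) → Ω) → ℝ) :
    pcov (prodDist p (n + 1)) f g =
      pmean p (fun a => pcov (prodDist p n) (fun z => f (Fin.cons a z))
        (fun z => g (Fin.cons a z))) +
      pcov p (fun a => pmean (prodDist p n) (fun z => f (Fin.cons a z)))
        (fun a => pmean (prodDist p n) (fun z => g (Fin.cons a z))) := by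
  simp only [pcov, pmean_prodDist_succ, pmean_sub]
  ring

/-- Tensorization of maximal correlation. -/
theorem CorrLE.prodDist {Ω A B : Type*} [Fintype Ω] {p : Ω → ℝ} (hp : IsDist p) {X : Ω → A}
    {Y : Ω → B} {r : ℝ} (h : CorrLE p X Y r) (n : ℕ) :
    CorrLE (prodDist p n) (fun z i => X (z i)) (fun z i => Y (z i)) r := by
  induction n with
  | zero => intro f g; simp [pcov, pmean, NIS.prodDist]
  | succ n ih =>
    intro f g
    have hX (a : Ω) (z : Fin n → Ω) : (fun i => X ((Fin.cons a z : Fin (n + 1) → Ω) i)) =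
        (Fin.cons (X a) fun i => X (z i) : Fin (n + 1) → A) := by
      funext i; cases i using Fin.cases <;> simp
    have hY (a : Ω) (z : Fin n → Ω) : (fun i => Y ((Fin.cons a z : Fin (n + 1) → Ω) i)) =
        (Fin.cons (Y a) fun i => Y (z i) : Fin (n + 1) → B) := by
      funext i; cases i using Fin.cases <;> simp
    simp only [pcov_prodDist_succ, hX, hY]
    have h₁ := pmean_mono hp fun a => ih (fun x => f (Fin.cons (X a) x))
      (fun y => g (Fin.cons (Y a) y))
    have h₂ := h
      (fun a => pmean (NIS.prodDist p n) fun z => f (Fin.cons a fun i => X (z i)))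
      (fun b => pmean (NIS.prodDist p n) fun z => g (Fin.cons b fun i => Y (z i)))
    rw [pmean_const_mul, pmean_const_mul, pmean_add] at h₁
    linarith

theorem pmean_push {A B U V : Type*} [Fintype A] [Fintype B] [Fintype U] [Fintype V]
    (μ : A × B → ℝ) (n : ℕ) (f : (Fin n → A) → U) (g : (Fin n → B) → V) (h : U × V → ℝ) :
    pmean (push μ n f g) h =
      pmean (prodDist μ n) (fun z => h (f fun i => (z i).1, g fun i => (z i).2)) := by
  simp only [pmean, push, prodDist, Finset.sum_mul]
  rw [Finset.sum_comm]
  refine Finset.sum_congr rfl fun z _ => ?_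
  rw [Finset.sum_eq_single (f fun i => (z i).1, g fun i => (z i).2)]
  · simp
  · rintro ⟨u, v⟩ - huv
    rw [if_neg, zero_mul]
    rintro ⟨rfl, rfl⟩
    exact huv rfl
  · simp

theorem tendsto_pmean_of_tvDist {Ω : Type*} [Fintype Ω] {p : ℕ → Ω → ℝ} {q : Ω → ℝ}
    (h : Tendsto (fun n => tvDist (p n) q) atTop (nhds 0)) (f : Ω → ℝ) :
    Tendsto (fun n => pmean (p n) f) atTop (nhds (pmean q f)) := by
  refine tendsto_finsetSum _ fun ω _ => Tendsto.mul_const _ ?_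
  rw [tendsto_iff_dist_tendsto_zero]
  refine squeeze_zero (fun _ => dist_nonneg) (fun n => ?_) (by simpa using h.const_mul 2)
  rw [Real.dist_eq, tvDist, ← mul_assoc, mul_one_div_cancel two_ne_zero, one_mul]
  exact Finset.single_le_sum (f := fun ω => |p n ω - q ω|) (fun _ _ => abs_nonneg _)
    (Finset.mem_univ ω)

theorem tendsto_pcov_of_tvDist {Ω : Type*} [Fintype Ω] {p : ℕ → Ω → ℝ} {q : Ω → ℝ}
    (h : Tendsto (fun n => tvDist (p n) q) atTop (nhds 0)) (f g : Ω → ℝ) :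
    Tendsto (fun n => pcov (p n) f g) atTop (nhds (pcov q f g)) :=
  (tendsto_pmean_of_tvDist h _).sub
    ((tendsto_pmean_of_tvDist h f).mul (tendsto_pmean_of_tvDist h g))

theorem corrLE_push {A B U V : Type*} [Fintype A] [Fintype B] [Fintype U] [Fintype V]
    {μ : A × B → ℝ} (hμ : IsDist μ) {r : ℝ} (h : CorrLE μ Prod.fst Prod.snd r) (n : ℕ)
    (f : (Fin n → A) → U) (g : (Fin n → B) → V) :
    CorrLE (push μ n f g) Prod.fst Prod.snd r := by
  intro φ ψ
  simp only [pcov, pmean_push]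
  exact (h.prodDist hμ n).comp f g φ ψ

/-- Necessary condition for non-interactive simulation: if `ν` can be
non-interactively simulated from `μ`, then `ρ(𝒰,𝒱;ν) ≤ ρ(𝒜,ℬ;μ)`. -/
theorem stmt14 {A B U V : Type*} [Fintype A] [Fintype B] [Fintype U] [Fintype V]
    (μ : A × B → ℝ) (hμ : IsDist μ) (ν : U × V → ℝ) (hν : IsDist ν)
    (h : CanSimulate μ ν) : maxCorr ν ≤ maxCorr μ := by
  obtain ⟨f, g, hfg⟩ := h
  refine CorrLE.maxCorr_le hν (maxCorr_nonneg hμ) fun φ ψ => ?_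
  exact le_of_tendsto_of_tendsto' ((tendsto_pcov_of_tvDist hfg _ _).const_mul 2)
    (((tendsto_pcov_of_tvDist hfg _ _).add (tendsto_pcov_of_tvDist hfg _ _)).const_mul _)
    fun n => corrLE_push hμ (corrLE_maxCorr hμ) n (f n) (g n) φ ψ

end NIS
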